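/- Let λ₀ < λ be infinite cardinals with λ singular. Let S be a family of sets with card(S) = λ and card(A) ≤ λ₀ for every A ∈ S. If every subfamily S₀ ⊆ S with card(S₀) < λ has a transversal, then S has a transversal. -/

import Mathlib

open Cardinal

universe u

lemma tsc_iUnion_le {β ι : Type u} (f : ι → Set β) (c : Cardinal.{u}) (hc : ℵ₀ ≤ c)
    (h1 : #ι ≤ c) (h2 : ∀ i, #(f i) ≤ c) : #(⋃ i, f i) ≤ c := by
  refine (mk_iUnion_le f).trans ?_
  refine (mul_le_mul' h1 (ciSup_le' h2)).trans ?_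
  rw [mul_eq_self hc]

lemma tsc_union_le {β : Type u} (s t : Set β) (c : Cardinal.{u}) (hc : ℵ₀ ≤ c)
    (h1 : #s ≤ c) (h2 : #t ≤ c) : #(s ∪ t : Set β) ≤ c := by
  refine (mk_union_le s t).trans ?_
  refine (add_le_add h1 h2).trans ?_
  rw [add_eq_self hc]

/-- the fibre bound: an injective choice on `D` hits `⋃₀ Y` at most `c` times. -/
lemma tsc_fib {α : Type u} (c : Cardinal.{u}) (hc : ℵ₀ ≤ c) (D Y : Set (Set α))
    (t : Set α → α) (ht : Set.InjOn t D) (hY : #Y ≤ c) (hs : ∀ A ∈ Y, #A ≤ c) :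
    #{A | A ∈ D ∧ t A ∈ ⋃₀ Y} ≤ c := by
  rw [← mk_image_eq_of_injOn t _ (ht.mono (fun A h => h.1))]
  refine (mk_le_mk_of_subset (t := ⋃ A : Y, (A : Set α)) ?_).trans
    (tsc_iUnion_le _ c hc hY (fun A => hs A A.2))
  rintro _ ⟨A, ⟨-, B, hB, hAB⟩, rfl⟩
  exact Set.mem_iUnion.2 ⟨⟨B, hB⟩, hAB⟩

/-- `t` is a transversal of `Z \ Y` avoiding `⋃₀ Y`. -/
def TscFree {α : Type u} (Y Z : Set (Set α)) : Prop :=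
  ∃ t : Set α → α, Set.InjOn t (Z \ Y) ∧ ∀ A ∈ Z \ Y, t A ∈ A ∧ t A ∉ ⋃₀ Y

def TscGood {α : Type u} (S : Set (Set α)) (μ : Cardinal.{u}) (Y : Set (Set α)) : Prop :=
  Y ⊆ S ∧ #Y ≤ μ ∧ ∀ Z ⊆ S, Y ⊆ Z → #Z ≤ μ → TscFree Y Z

lemma tsc_exists_good {α : Type u} (S : Set (Set α)) (μ : Cardinal.{u}) (hμ : ℵ₀ ≤ μ)
    (hsize : ∀ A ∈ S, #A ≤ μ)
    (htr : ∀ Z ⊆ S, #Z ≤ Order.succ μ → ∃ t : Set α → α, Set.InjOn t Z ∧ ∀ A ∈ Z, t A ∈ A)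
    (X : Set (Set α)) (hXS : X ⊆ S) (hX : #X ≤ μ) :
    ∃ Y, X ⊆ Y ∧ TscGood S μ Y := by
  by_contra! hcon
  have hN : ∀ Y : Set (Set α), ∃ Z, X ⊆ Y → Y ⊆ S → #Y ≤ μ →
      Z ⊆ S ∧ Y ⊆ Z ∧ #Z ≤ μ ∧ ¬ TscFree Y Z := by
    intro Y
    by_cases h : X ⊆ Y ∧ Y ⊆ S ∧ #Y ≤ μ
    · have := hcon Y h.1
      unfold TscGood at this
      push Not at this
      obtain ⟨Z, h1, h2, h3, h4⟩ := this h.2.1 h.2.2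
      exact ⟨Z, fun _ _ _ => ⟨h1, h2, h3, h4⟩⟩
    · exact ⟨∅, fun a b c => absurd ⟨a, b, c⟩ h⟩
  choose N hN using hN
  let I := (Order.succ μ).ord.ToType
  have hI : #I = Order.succ μ := mk_ord_toType _
  have hIio : ∀ a : I, #(Set.Iio a) ≤ μ := fun a =>
    Order.lt_succ_iff.1 (mk_Iio_toType_ord_lt a)
  have hinf : ℵ₀ ≤ Order.succ μ := hμ.trans (Order.le_succ μ)
  -- bounded sets
  have hbdd : ∀ s : Set I, #s ≤ μ → ∃ b, ∀ a ∈ s, a < b := by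
    intro s hs
    by_contra! hb
    have : (Set.univ : Set I) ⊆ ⋃ a : s, (Set.Iio (a : I) ∪ {(a : I)}) := by
      intro b _
      obtain ⟨a, ha, hab⟩ := hb b
      refine Set.mem_iUnion.2 ⟨⟨a, ha⟩, ?_⟩
      rcases hab.lt_or_eq with h | h
      · exact Or.inl h
      · exact Or.inr h
    have h2 := mk_le_mk_of_subset this
    rw [mk_univ, hI] at h2
    have h3 : #(⋃ a : s, (Set.Iio (a : I) ∪ {(a : I)}) : Set I) ≤ μ :=
      tsc_iUnion_le _ μ hμ hs (fun a => tsc_union_le _ _ μ hμ (hIio a)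
        (by rw [mk_singleton]; exact one_le_aleph0.trans hμ))
    exact absurd (h2.trans h3) (not_le.2 (Order.lt_succ μ))
  have hwf : WellFounded ((· < ·) : I → I → Prop) := wellFounded_lt
  let Y : I → Set (Set α) := hwf.fix (fun a F => X ∪ ⋃ b : Set.Iio a, N (F b b.2))
  have hY : ∀ a, Y a = X ∪ ⋃ b : Set.Iio a, N (Y b) := fun a => hwf.fix_eq _ a
  have hXY : ∀ a, X ⊆ Y a := fun a => by rw [hY]; exact Set.subset_union_left
  have hprop : ∀ a, Y a ⊆ S ∧ #(Y a) ≤ μ := by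
    intro a
    induction a using hwf.induction with
    | _ a ih =>
      rw [hY]
      constructor
      · refine Set.union_subset hXS (Set.iUnion_subset fun b => ?_)
        exact (hN _ (hXY b) (ih b b.2).1 (ih b b.2).2).1
      · refine tsc_union_le _ _ μ hμ hX (tsc_iUnion_le _ μ hμ (hIio a) fun b => ?_)
        exact (hN _ (hXY b) (ih b b.2).1 (ih b b.2).2).2.2.1
  have hNY : ∀ a, N (Y a) ⊆ S ∧ Y a ⊆ N (Y a) ∧ #(N (Y a)) ≤ μ ∧ ¬ TscFree (Y a) (N (Y a)) :=
    fun a => hN _ (hXY a) (hprop a).1 (hprop a).2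
  have hlt : ∀ a b, a < b → N (Y a) ⊆ Y b := by
    intro a b hab
    rw [hY b]
    exact (Set.subset_iUnion (fun c : Set.Iio b => N (Y c)) ⟨a, hab⟩).trans
      Set.subset_union_right
  have hmono : ∀ a b, a ≤ b → Y a ⊆ Y b := by
    intro a b hab
    rcases hab.lt_or_eq with h | h
    · exact (hNY a).2.1.trans (hlt a b h)
    · rw [h]
  obtain ⟨t, htinj, htmem⟩ := htr (⋃ a, Y a) (Set.iUnion_subset fun a => (hprop a).1)
    (tsc_iUnion_le _ _ hinf hI.le fun a => (hprop a).2.trans (Order.le_succ μ))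
  -- closing off
  have hstep : ∀ a : I, ∃ b, a < b ∧ ∀ A ∈ ⋃ a, Y a, t A ∈ ⋃₀ Y a → A ∈ Y b := by
    intro a
    have hF := tsc_fib μ hμ (⋃ a, Y a) (Y a) t htinj (hprop a).2
      (fun A hA => hsize A ((hprop a).1 hA))
    have : ∀ A : {A | A ∈ ⋃ a, Y a ∧ t A ∈ ⋃₀ Y a}, ∃ b, (A : Set α) ∈ Y b :=
      fun A => Set.mem_iUnion.1 A.2.1
    choose f hf using this
    obtain ⟨b, hb⟩ := hbdd (Set.range f ∪ {a}) (tsc_union_le _ _ μ hμ (mk_range_le.trans hF)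
      (by rw [mk_singleton]; exact one_le_aleph0.trans hμ))
    exact ⟨b, hb a (Or.inr rfl), fun A hA hA' =>
      hmono _ _ (hb _ (Or.inl ⟨⟨A, hA, hA'⟩, rfl⟩)).le (hf ⟨A, hA, hA'⟩)⟩
  choose g hg1 hg2 using hstep
  have hne : Nonempty I := by
    rw [← mk_ne_zero_iff, hI]
    exact (aleph0_pos.trans_le hinf).ne'
  obtain ⟨a0⟩ := hne
  let s : ℕ → I := fun n => g^[n] a0
  have hs : ∀ n, s (n + 1) = g (s n) := fun n => Function.iterate_succ_apply' g n a0
  have hub : ∃ b, ∀ n, s n < b := by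
    obtain ⟨b, hb⟩ := hbdd (Set.range s)
      ((Set.countable_range s).le_aleph0.trans hμ)
    exact ⟨b, fun n => hb _ ⟨n, rfl⟩⟩
  let a := hwf.min {b | ∀ n, s n < b} hub
  have ha : ∀ n, s n < a := hwf.min_mem {b | ∀ n, s n < b} hub
  have ha' : ∀ b < a, ∃ n, b ≤ s n := by
    intro b hb
    by_contra! h
    exact hwf.not_lt_min {b | ∀ n, s n < b} h hb
  have hYa : ∀ A ∈ Y a, ∃ n, A ∈ Y (s n) := by
    intro A hA
    rw [hY a] at hA
    rcases hA with hA | hA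
    · exact ⟨0, hXY _ hA⟩
    · obtain ⟨⟨b, hb⟩, hA⟩ := Set.mem_iUnion.1 hA
      obtain ⟨n, hn⟩ := ha' b hb
      refine ⟨n + 1, hlt b _ (hn.trans_lt ?_) hA⟩
      rw [hs]; exact hg1 _
  obtain ⟨c, hc⟩ := hbdd {a} (by rw [mk_singleton]; exact one_le_aleph0.trans hμ)
  have hsub : N (Y a) ⊆ ⋃ a, Y a :=
    (hlt a c (hc a rfl)).trans (Set.subset_iUnion Y c)
  refine (hNY a).2.2.2 ⟨t, htinj.mono (Set.diff_subset.trans hsub), ?_⟩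
  rintro A ⟨hA, hA'⟩
  refine ⟨htmem A (hsub hA), ?_⟩
  rintro ⟨B, hB, hAB⟩
  obtain ⟨n, hn⟩ := hYa B hB
  apply hA'
  apply hmono _ _ (ha (n + 1)).le
  rw [hs]
  exact hg2 (s n) A (hsub hA) ⟨B, hn, hAB⟩

structure TscState {α I : Type u} (S : Set (Set α)) (μ : I → Cardinal.{u}) where
  Y : I → Set (Set α)
  t : I → Set α → α
  good : ∀ i, TscGood S (μ i) (Y i)
  inj : ∀ i, Set.InjOn (t i) (Y i)
  mem : ∀ i, ∀ A ∈ Y i, t i A ∈ A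

lemma tsc_next {α I : Type u} (S : Set (Set α)) (μ : I → Cardinal.{u}) (hμ : ∀ i, ℵ₀ ≤ μ i)
    (hsize : ∀ i, ∀ A ∈ S, #A ≤ μ i) (hI : ∀ i, #I ≤ μ i)
    (hgood : ∀ i, ∀ X ⊆ S, #X ≤ μ i → ∃ Y, X ⊆ Y ∧ TscGood S (μ i) Y)
    (x : TscState S μ) : ∃ y : TscState S μ, (∀ i, x.Y i ⊆ y.Y i) ∧
      (∀ i, ∀ A ∈ x.Y i, y.t i A = x.t i A) ∧
      (∀ i j, ∀ A ∈ x.Y j, x.t j A ∈ ⋃₀ x.Y i → A ∈ y.Y i) := by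
  have h1 : ∀ i, ∃ Z, (x.Y i ∪ ⋃ j, {A | A ∈ x.Y j ∧ x.t j A ∈ ⋃₀ x.Y i}) ⊆ Z ∧
      TscGood S (μ i) Z := by
    intro i
    apply hgood
    · refine Set.union_subset (x.good i).1 (Set.iUnion_subset fun j A hA => (x.good j).1 hA.1)
    · refine tsc_union_le _ _ _ (hμ i) (x.good i).2.1
        (tsc_iUnion_le _ _ (hμ i) (hI i) fun j => ?_)
      exact tsc_fib _ (hμ i) _ _ _ (x.inj j) (x.good i).2.1
        (fun A hA => hsize i A ((x.good i).1 hA))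
  choose Z hZ1 hZ2 using h1
  have h2 : ∀ i, TscFree (x.Y i) (Z i) := fun i =>
    (x.good i).2.2 (Z i) (hZ2 i).1 (Set.subset_union_left.trans (hZ1 i)) (hZ2 i).2.1
  choose r hr1 hr2 using h2
  classical
  refine ⟨⟨Z, fun i A => if A ∈ x.Y i then x.t i A else r i A, hZ2, ?_, ?_⟩, ?_, ?_, ?_⟩
  · intro i A hA B hB hAB
    by_cases h : A ∈ x.Y i <;> by_cases h' : B ∈ x.Y i <;> simp only [h, h', if_true, if_false] at hAB
    · exact x.inj i h h' hAB
    · exact absurd ⟨A, h, hAB ▸ x.mem i A h⟩ (hr2 i B ⟨hB, h'⟩).2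
    · exact absurd ⟨B, h', hAB ▸ x.mem i B h'⟩ (hr2 i A ⟨hA, h⟩).2
    · exact hr1 i ⟨hA, h⟩ ⟨hB, h'⟩ hAB
  · intro i A hA
    by_cases h : A ∈ x.Y i <;> simp only [h, if_true, if_false]
    · exact x.mem i A h
    · exact (hr2 i A ⟨hA, h⟩).1
  · exact fun i => Set.subset_union_left.trans (hZ1 i)
  · intro i A hA
    simp [hA]
  · intro i j A hA hA'
    exact hZ1 i (Or.inr (Set.mem_iUnion.2 ⟨j, hA, hA'⟩))

lemma tsc_main {α I : Type u} (S : Set (Set α)) (μ : I → Cardinal.{u}) (hμ : ∀ i, ℵ₀ ≤ μ i)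
    (hsize : ∀ i, ∀ A ∈ S, #A ≤ μ i) (hI : ∀ i, #I ≤ μ i)
    (htr : ∀ i, ∀ Z ⊆ S, #Z ≤ Order.succ (μ i) →
      ∃ t : Set α → α, Set.InjOn t Z ∧ ∀ A ∈ Z, t A ∈ A)
    (C : I → Set (Set α)) (hCS : ∀ i, C i ⊆ S) (hC : ∀ i, #(C i) ≤ μ i)
    (hcov : ∀ A ∈ S, ∃ i, A ∈ C i) :
    ∃ t : S → α, Function.Injective t ∧ ∀ A : S, t A ∈ (A : Set α) := by
  have hgood : ∀ i, ∀ X ⊆ S, #X ≤ μ i → ∃ Y, X ⊆ Y ∧ TscGood S (μ i) Y := fun i X hX hX' =>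
    tsc_exists_good S (μ i) (hμ i) (hsize i) (htr i) X hX hX'
  choose Y0 hY0 hY0' using fun i => hgood i (C i) (hCS i) (hC i)
  choose t0 ht0 ht0' using fun i => htr i (Y0 i) (hY0' i).1 ((hY0' i).2.1.trans (Order.le_succ _))
  choose nx hn1 hn2 hn3 using tsc_next S μ hμ hsize hI hgood
  let x : ℕ → TscState S μ := fun n => nx^[n] ⟨Y0, t0, hY0', ht0, ht0'⟩
  have hx : ∀ n, x (n + 1) = nx (x n) := fun n => Function.iterate_succ_apply' nx n _
  have hmono : ∀ i m n, m ≤ n → (x m).Y i ⊆ (x n).Y i := by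
    intro i m n h
    induction h with
    | refl => exact subset_rfl
    | step _ ih => refine ih.trans ?_; rw [hx]; exact hn1 _ i
  have hcoh : ∀ i m n, m ≤ n → ∀ A ∈ (x m).Y i, (x n).t i A = (x m).t i A := by
    intro i m n h A hA
    induction h with
    | refl => rfl
    | step h ih => rw [hx, hn2 _ i A (hmono i _ _ h hA), ih]
  -- every member appears
  have hidx : ∀ A : S, ∃ i, ∃ n, (A : Set α) ∈ (x n).Y i := fun A => by
    obtain ⟨i, hi⟩ := hcov A A.2
    exact ⟨i, 0, hY0 i hi⟩
  have hwf : WellFounded (WellOrderingRel (α := I)) := WellOrderingRel.isWellOrder.wf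
  have hmin : ∀ A : S, ∃ i, (∃ n, (A : Set α) ∈ (x n).Y i) ∧
      ∀ j, (∃ n, (A : Set α) ∈ (x n).Y j) → ¬ WellOrderingRel j i := fun A =>
    ⟨hwf.min {i | ∃ n, (A : Set α) ∈ (x n).Y i} (hidx A),
      hwf.min_mem {i | ∃ n, (A : Set α) ∈ (x n).Y i} _, fun j hj => hwf.not_lt_min {i | ∃ n, (A : Set α) ∈ (x n).Y i} hj⟩
  choose ι hι hι' using hmin
  choose n hn using hι
  have key : ∀ A B : S, WellOrderingRel (ι B) (ι A) →
      (x (n A)).t (ι A) A = (x (n B)).t (ι B) B → False := by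
    intro A B hlt hAB
    apply hι' A (ι B) _ hlt
    refine ⟨max (n A) (n B) + 1, ?_⟩
    rw [hx]
    apply hn3 _ (ι B) (ι A) A (hmono _ _ _ (le_max_left _ _) (hn A))
    refine ⟨B, hmono _ _ _ (le_max_right _ _) (hn B), ?_⟩
    rw [hcoh _ _ _ (le_max_left _ _) _ (hn A), hAB]
    exact (x (n B)).mem _ _ (hn B)
  refine ⟨fun A => (x (n A)).t (ι A) A, ?_, fun A => (x (n A)).mem _ _ (hn A)⟩
  intro A B hAB
  rcases trichotomous_of WellOrderingRel (ι A) (ι B) with h | h | h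
  · exact (key B A h hAB.symm).elim
  · apply Subtype.ext
    simp only at hAB
    rw [← hcoh _ _ _ (le_max_left (n A) (n B)) _ (hn A),
      ← hcoh _ _ _ (le_max_right (n A) (n B)) _ (hn B), ← h] at hAB
    exact (x (max (n A) (n B))).inj (ι A) (hmono _ _ _ (le_max_left _ _) (hn A))
      (hmono _ _ _ (le_max_right _ _) (h ▸ hn B)) hAB
  · exact (key A B h hAB).elim

/-- Singular compactness for transversals: if `λ₀ < λ` are infinite cardinals with `λ`
singular, `S` is a family of sets with `card S = λ` and each member of size `≤ λ₀`, and
every subfamily of size `< λ` has a transversal (a system of distinct representatives),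
then `S` has a transversal. -/
theorem transversal_singular_compactness {α : Type u} (lam₀ lam : Cardinal.{u})
    (h₀ : ℵ₀ ≤ lam₀) (hlt : lam₀ < lam) (hsing : lam.ord.cof < lam)
    (S : Set (Set α)) (hcard : #S = lam) (hsize : ∀ A ∈ S, #A ≤ lam₀)
    (htr : ∀ S₀ : Set (Set α), S₀ ⊆ S → #S₀ < lam →
      ∃ t : S₀ → α, Function.Injective t ∧ ∀ A : S₀, t A ∈ (A : Set α)) :
    ∃ t : S → α, Function.Injective t ∧ ∀ A : S, t A ∈ (A : Set α) := by
  have hinf : ℵ₀ ≤ lam := h₀.trans hlt.le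
  have hsucc : ∀ c < lam, Order.succ (max c lam₀) < lam := by
    intro c hc
    refine lt_of_le_of_ne (Order.succ_le_of_lt (max_lt hc hlt)) ?_
    intro h
    have := (isRegular_succ (h₀.trans (le_max_right c lam₀))).cof_ord
    rw [h] at this
    exact hsing.ne this
  have hα : Nonempty α := by
    have hS : #S ≠ 0 := by rw [hcard]; exact (aleph0_pos.trans_le hinf).ne'
    obtain ⟨A⟩ := mk_ne_zero_iff.1 hS
    obtain ⟨t, -, -⟩ := htr {(A : Set α)} (by simp)
      (by rw [mk_singleton]; exact one_lt_aleph0.trans_le hinf)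
    exact ⟨t ⟨A, rfl⟩⟩
  have htr' : ∀ Z ⊆ S, #Z < lam → ∃ t : Set α → α, Set.InjOn t Z ∧ ∀ A ∈ Z, t A ∈ A := by
    classical
    intro Z hZ hZ'
    obtain ⟨t, h1, h2⟩ := htr Z hZ hZ'
    refine ⟨fun A => if h : A ∈ Z then t ⟨A, h⟩ else Classical.arbitrary α, ?_, ?_⟩
    · intro A hA B hB hAB
      simp only [hA, hB, dif_pos] at hAB
      exact congrArg Subtype.val (h1 hAB)
    · intro A hA
      simp only [hA, dif_pos]
      exact h2 ⟨A, hA⟩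
  obtain ⟨s, hs, hs'⟩ := Order.exists_cof_eq lam.ord.ToType
  rw [Ordinal.cof_toType] at hs'
  obtain ⟨e⟩ : Nonempty (S ≃ lam.ord.ToType) := Cardinal.eq.1 (by rw [hcard, mk_ord_toType])
  let C : s → Set (Set α) := fun i => (fun a => (e.symm a : Set α)) '' (Set.Iio (i : lam.ord.ToType) ∪ {(i : lam.ord.ToType)})
  have hC : ∀ i, #(C i) < lam := fun i => by
    refine mk_image_le.trans_lt ((mk_union_le _ _).trans_lt ?_)
    refine add_lt_of_lt hinf (mk_Iio_toType_ord_lt _) ?_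
    rw [mk_singleton]; exact one_lt_aleph0.trans_le hinf
  have hμ : ∀ i, max (#(C i)) #s < lam := fun i => max_lt (hC i) (hs' ▸ hsing)
  refine tsc_main S (fun i : s => max (max (#(C i)) #s) lam₀) (fun i => h₀.trans (le_max_right _ _))
    (fun i A hA => (hsize A hA).trans (le_max_right _ _))
    (fun i => (le_max_right _ _).trans (le_max_left _ _))
    (fun i Z hZ hZ' => htr' Z hZ (hZ'.trans_lt (hsucc _ (hμ i)))) C ?_
    (fun i => (le_max_left _ _).trans (le_max_left _ _)) ?_
  · rintro i _ ⟨a, -, rfl⟩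
    exact (e.symm a).2
  · intro A hA
    obtain ⟨b, hb, hab⟩ := hs (e ⟨A, hA⟩)
    refine ⟨⟨b, hb⟩, e ⟨A, hA⟩, ?_, by simp⟩
    rcases hab.lt_or_eq with h | h
    · exact Or.inl h
    · exact Or.inr h
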